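/- Let D = D_h be a balanced domain in ℂ^n and let h̃ : ℂ^n → [0,∞) be upper semicontinuous, absolutely homogeneous with h̃ ≤ h (so D_h ⊆ D_{h̃}). If every f ∈ L²_h(D_h) admits a holomorphic extension to D_{h̃}, then h̃ ≥ h_BK^* on ℂ^n. (Together with the extension property of D_{h_BK^*}, this says the L²_h-envelope of holomorphy of D_h is exactly D_{h_BK^*}.) -/

import Mathlib

open MeasureTheory Filter Topology
open scoped ENNReal NNReal

noncomputable section

/-- `f` belongs to the Bergman space `L²_h(D)`: holomorphic on `D` and square integrable. -/
def MemL2h {n : ℕ} (D : Set (Fin n → ℂ)) (f : (Fin n → ℂ) → ℂ) : Prop :=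
  DifferentiableOn ℂ f D ∧ (∫⁻ z in D, (‖f z‖₊ : ℝ≥0∞) ^ 2) < ⊤

/-- `h` is absolutely homogeneous. -/
def AbsHomog {n : ℕ} (h : (Fin n → ℂ) → ℝ) : Prop :=
  ∀ (c : ℂ) (z : Fin n → ℂ), h (c • z) = ‖c‖ * h z

/-- `log h` is plurisubharmonic (sub-mean value inequality on complex lines, where the
possibly `-∞`-valued integrand is handled via truncations `max · c`). -/
def LogPSH {n : ℕ} (h : (Fin n → ℂ) → ℝ) : Prop :=
  ∀ (a b : Fin n → ℂ) (r : ℝ), 0 < r → h a ≠ 0 → ∀ c : ℝ,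
    Real.log (h a) ≤ (1 / (2 * Real.pi)) *
      ∫ θ in (0:ℝ)..(2 * Real.pi),
        max (Real.log (h (a + ((r : ℂ) * Complex.exp (θ * Complex.I)) • b))) c

/-- `M_d(z)`: sup of `|P(z)|` over homogeneous polynomials `P` of degree `d` with
`∫_{D_h} |P|² dλ ≤ 1`. -/
def Md {n : ℕ} (h : (Fin n → ℂ) → ℝ) (d : ℕ) (z : Fin n → ℂ) : ℝ≥0∞ :=
  ⨆ (P : MvPolynomial (Fin n) ℂ) (_ : P.IsHomogeneous d)
    (_ : (∫⁻ w in {w | h w < 1}, (‖MvPolynomial.eval w P‖₊ : ℝ≥0∞) ^ 2) ≤ 1),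
    (‖MvPolynomial.eval z P‖₊ : ℝ≥0∞)

/-- `h_BK(z) = limsup_{d → ∞} M_d(z)^{1/d}`. -/
def hBK {n : ℕ} (h : (Fin n → ℂ) → ℝ) (z : Fin n → ℂ) : ℝ≥0∞ :=
  Filter.limsup (fun d : ℕ => (Md h d z) ^ (1 / (d : ℝ))) atTop

/-- Upper semicontinuous regularization of `h_BK`. -/
def hBKstar {n : ℕ} (h : (Fin n → ℂ) → ℝ) (z : Fin n → ℂ) : ℝ≥0∞ :=
  Filter.limsup (hBK h) (𝓝 z)

/-- The Bergman kernel of `D` on the diagonal. -/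
def bergmanK {n : ℕ} (D : Set (Fin n → ℂ)) (z : Fin n → ℂ) : ℝ≥0∞ :=
  ⨆ (f : (Fin n → ℂ) → ℂ) (_ : DifferentiableOn ℂ f D)
    (_ : (∫⁻ w in D, (‖f w‖₊ : ℝ≥0∞) ^ 2) ≤ 1), (‖f z‖₊ : ℝ≥0∞) ^ 2

/-- `D` is an `L²_h`-domain of holomorphy. -/
def IsL2hDomainOfHolomorphy {n : ℕ} (D : Set (Fin n → ℂ)) : Prop :=
  ¬ ∃ D₀ D₁ : Set (Fin n → ℂ), IsOpen D₀ ∧ IsOpen D₁ ∧ IsConnected D₀ ∧ IsConnected D₁ ∧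
      D₀ ⊆ D₁ ∩ D ∧ ¬ (D₁ ⊆ D) ∧
      ∀ f : (Fin n → ℂ) → ℂ, MemL2h D f →
        ∃ F : (Fin n → ℂ) → ℂ, DifferentiableOn ℂ F D₁ ∧ Set.EqOn F f D₀

/-- The Lelong number `ν(log h, [v])` of `log h` at the direction `[v] ∈ ℙ¹`. -/
def lelong (h : (Fin 2 → ℂ) → ℝ) (v : Fin 2 → ℂ) : ℝ :=
  if v 1 ≠ 0 then
    Filter.limsup (fun r : ℝ =>
      (⨆ θ : ℝ, Real.log (h ![v 0 + (r : ℂ) * Complex.exp (θ * Complex.I), v 1])) / Real.log r)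
      (𝓝[>] 0)
  else
    Filter.limsup (fun r : ℝ =>
      (⨆ θ : ℝ, Real.log (h ![v 0, (r : ℂ) * Complex.exp (θ * Complex.I)])) / Real.log r)
      (𝓝[>] 0)

/-- `m(Q,[v])`: the largest `k` such that `(v₂ z₁ - v₁ z₂)^k` divides `Q`. -/
def multAt (v : Fin 2 → ℂ) (Q : MvPolynomial (Fin 2) ℂ) : ℕ :=
  sSup {k : ℕ |
    (MvPolynomial.C (v 1) * MvPolynomial.X 0 - MvPolynomial.C (v 0) * MvPolynomial.X 1) ^ k ∣ Q}

/-- Multiplication by a unimodular scalar preserves Lebesgue measure on `ℂⁿ`. -/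
lemma measurePreserving_circle_smul {n : ℕ} (u : Circle) :
    MeasurePreserving (fun w : Fin n → ℂ => (u : ℂ) • w) volume volume :=
  volume_preserving_pi (fun _ : Fin n => (rotation u).measurePreserving)

/-- The sub-mean value inequality for the modulus of a holomorphic function, on circles. -/
lemma enorm_le_lintegral_circle {f : ℂ → ℂ} (hf : Differentiable ℂ f) :
    ENNReal.ofReal (2 * Real.pi) * ‖f 0‖ₑ ≤
      ∫⁻ θ in Set.Ioc 0 (2 * Real.pi), ‖f (circleMap 0 1 θ)‖ₑ := by
  have h := (hf.diffContOnCl (s := Metric.ball 0 |(1 : ℝ)|)).circleAverage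
  rw [Real.circleAverage_def, intervalIntegral.integral_of_le (by positivity)] at h
  have h2 : ((2 * Real.pi : ℝ) : ℂ) * f 0 =
      ∫ θ in Set.Ioc 0 (2 * Real.pi), f (circleMap 0 1 θ) := by
    rw [← h, Complex.real_smul, ← mul_assoc, ← Complex.ofReal_mul,
      mul_inv_cancel₀ (by positivity), Complex.ofReal_one, one_mul]
  calc ENNReal.ofReal (2 * Real.pi) * ‖f 0‖ₑ = ‖((2 * Real.pi : ℝ) : ℂ) * f 0‖ₑ := by
        rw [enorm_mul, ← ofReal_norm (((2 * Real.pi : ℝ) : ℂ)), Complex.norm_real,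
          Real.norm_of_nonneg (by positivity)]
    _ ≤ _ := by rw [h2]; exact enorm_integral_le_lintegral_enorm _

/-- The sub-mean value inequality for the modulus of a holomorphic function, on polydiscs. -/
lemma volume_ball_mul_enorm_le {n : ℕ} {f : (Fin n → ℂ) → ℂ} (hf : Differentiable ℂ f)
    (a : Fin n → ℂ) (r : ℝ) :
    volume (Metric.ball (0 : Fin n → ℂ) r) * ‖f a‖ₑ ≤ ∫⁻ w in Metric.ball a r, ‖f w‖ₑ := by
  set B := Metric.ball (0 : Fin n → ℂ) r with hB
  set V := ∫⁻ w in Metric.ball a r, ‖f w‖ₑ with hV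
  have hshift : ∫⁻ w in B, ‖f (a + w)‖ₑ = V := by
    have := (measurePreserving_add_left volume a).setLIntegral_comp_preimage_emb
      (MeasurableEquiv.addLeft a).measurableEmbedding (fun w => ‖f w‖ₑ) (Metric.ball a r)
    rw [hV, ← this]
    congr 2
    ext w
    simp [hB]
  have hrot (θ : ℝ) : ∫⁻ w in B, ‖f (a + circleMap 0 1 θ • w)‖ₑ = V := by
    have hu : circleMap 0 1 θ = (Circle.exp θ : ℂ) := by simp [circleMap]
    rw [hu, ← hshift]
    have hm : MeasurableEmbedding (fun w : Fin n → ℂ => (Circle.exp θ : ℂ) • w) :=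
      measurableEmbedding_const_smul₀ (Circle.coe_ne_zero _)
    have := (measurePreserving_circle_smul (n := n) (Circle.exp θ)).setLIntegral_comp_preimage_emb
      hm (fun w => ‖f (a + w)‖ₑ) B
    rw [← this]
    congr 2
    ext w
    simp [hB, norm_smul]
  have hline (w : Fin n → ℂ) : ENNReal.ofReal (2 * Real.pi) * ‖f a‖ₑ ≤
      ∫⁻ θ in Set.Ioc 0 (2 * Real.pi), ‖f (a + circleMap 0 1 θ • w)‖ₑ := by
    have hg : Differentiable ℂ fun z : ℂ => f (a + z • w) := hf.comp (by fun_prop)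
    simpa using enorm_le_lintegral_circle hg
  have key : ENNReal.ofReal (2 * Real.pi) * (volume B * ‖f a‖ₑ) ≤
      ENNReal.ofReal (2 * Real.pi) * V :=
    calc ENNReal.ofReal (2 * Real.pi) * (volume B * ‖f a‖ₑ)
        = ∫⁻ _ in B, ENNReal.ofReal (2 * Real.pi) * ‖f a‖ₑ := by
          rw [setLIntegral_const]; ring
      _ ≤ ∫⁻ w in B, ∫⁻ θ in Set.Ioc 0 (2 * Real.pi), ‖f (a + circleMap 0 1 θ • w)‖ₑ :=
          lintegral_mono fun w => hline w
      _ = ∫⁻ θ in Set.Ioc 0 (2 * Real.pi), ∫⁻ w in B, ‖f (a + circleMap 0 1 θ • w)‖ₑ := by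
          apply lintegral_lintegral_swap
          have hc : Continuous f := hf.continuous
          have : Continuous fun p : (Fin n → ℂ) × ℝ => ‖f (a + circleMap 0 1 p.2 • p.1)‖ₑ := by
            fun_prop
          exact this.measurable.aemeasurable
      _ = ENNReal.ofReal (2 * Real.pi) * V := by
          simp_rw [hrot]
          rw [setLIntegral_const, Real.volume_Ioc, sub_zero, mul_comm]
  exact (ENNReal.mul_le_mul_iff_right (by simp [Real.pi_pos]) ENNReal.ofReal_ne_top).1 key

/-- Holomorphic functions with square integral at most `1` are uniformly bounded on the points
at a definite distance to the boundary. -/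
lemma exists_norm_le_of_lintegral_sq_le {n : ℕ} {r : ℝ} (hr : 0 < r) :
    ∃ C : ℝ, 0 < C ∧ ∀ (f : (Fin n → ℂ) → ℂ), Differentiable ℂ f → ∀ (D : Set (Fin n → ℂ)),
      (∫⁻ w in D, (‖f w‖₊ : ℝ≥0∞) ^ 2) ≤ 1 → ∀ a, Metric.ball a r ⊆ D → ‖f a‖ ≤ C := by
  set v := volume (Metric.ball (0 : Fin n → ℂ) r) with hv
  have hv0 : v ≠ 0 := (Metric.measure_ball_pos volume _ hr).ne'
  have hvt : v ≠ ⊤ := measure_ball_lt_top.ne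
  have hpos : 0 < v.toReal := ENNReal.toReal_pos hv0 hvt
  refine ⟨v.toReal⁻¹ + 1, by positivity, fun f hf D hD a ha => ?_⟩
  have h1 : v * ‖f a ^ 2‖ₑ ≤ 1 := by
    refine (volume_ball_mul_enorm_le (hf.pow 2) a r).trans (le_trans ?_ hD)
    refine (lintegral_mono_set ha).trans_eq ?_
    simp [enorm_eq_nnnorm]
  have h2 : v.toReal * ‖f a‖ ^ 2 ≤ 1 := by
    have := ENNReal.toReal_mono ENNReal.one_ne_top h1
    simpa using this
  have h3 : ‖f a‖ ^ 2 ≤ v.toReal⁻¹ := by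
    rw [← one_div, le_div_iff₀ hpos]; linarith
  nlinarith [sq_nonneg (‖f a‖ - 1), norm_nonneg (f a)]

/-- A Cauchy estimate for the Fréchet derivative. -/
lemma norm_fderiv_le_of_forall_mem_ball {n : ℕ} {f : (Fin n → ℂ) → ℂ} (hf : Differentiable ℂ f)
    {a : Fin n → ℂ} {r C : ℝ} (hr : 0 < r) (hC : ∀ z ∈ Metric.ball a r, ‖f z‖ ≤ C) :
    ‖fderiv ℂ f a‖ ≤ 2 * C / r := by
  refine Complex.norm_fderiv_le_div_of_mapsTo_ball hf.differentiableOn (fun z hz => ?_) hr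
  rw [Metric.mem_closedBall, dist_eq_norm]
  linarith [norm_sub_le (f z) (f a), hC z hz, hC a (Metric.mem_ball_self hr)]

section Series

variable {n : ℕ} {D : Set (Fin n → ℂ)} {P : ℕ → (Fin n → ℂ) → ℂ} {q : ℝ}

lemma summable_geometric_mul (hD : IsOpen D) (hP : ∀ d, Differentiable ℂ (P d))
    (hn : ∀ d, (∫⁻ w in D, (‖P d w‖₊ : ℝ≥0∞) ^ 2) ≤ 1) (hq0 : 0 ≤ q) (hq1 : q < 1)
    {a : Fin n → ℂ} (ha : a ∈ D) : Summable fun d => (q : ℂ) ^ d * P d a := by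
  obtain ⟨r, hr, hrD⟩ := Metric.isOpen_iff.1 hD a ha
  obtain ⟨C, -, hC⟩ := exists_norm_le_of_lintegral_sq_le (n := n) hr
  refine Summable.of_norm_bounded ((summable_geometric_of_lt_one hq0 hq1).mul_right C)
    fun d => ?_
  rw [norm_mul, norm_pow, Complex.norm_of_nonneg hq0]
  gcongr
  exact hC _ (hP d) D (hn d) a hrD

lemma differentiableOn_tsum_geometric_mul (hD : IsOpen D) (hP : ∀ d, Differentiable ℂ (P d))
    (hn : ∀ d, (∫⁻ w in D, (‖P d w‖₊ : ℝ≥0∞) ^ 2) ≤ 1) (hq0 : 0 ≤ q) (hq1 : q < 1) :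
    DifferentiableOn ℂ (fun z => ∑' d, (q : ℂ) ^ d * P d z) D := by
  intro a ha
  obtain ⟨r, hr, hrD⟩ := Metric.isOpen_iff.1 hD a ha
  obtain ⟨C, -, hC⟩ := exists_norm_le_of_lintegral_sq_le (n := n) (r := r / 3) (by positivity)
  have hd (d : ℕ) : Differentiable ℂ fun z => (q : ℂ) ^ d * P d z := (hP d).const_mul _
  refine (hasFDerivAt_tsum_of_isPreconnected (𝕜 := ℂ) (s := Metric.ball a (r / 3)) (x₀ := a)
    (f := fun d z => (q : ℂ) ^ d * P d z)
    (f' := fun d z => fderiv ℂ (fun z => (q : ℂ) ^ d * P d z) z)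
    (((summable_geometric_of_lt_one hq0 hq1).mul_right (2 * C / (r / 3))))
    Metric.isOpen_ball (convex_ball _ _).isPreconnected (fun d z _ => (hd d z).hasFDerivAt)
    (fun d z hz => ?_) (Metric.mem_ball_self (by positivity))
    (summable_geometric_mul hD hP hn hq0 hq1 ha)
    (Metric.mem_ball_self (by positivity))).differentiableAt.differentiableWithinAt
  have hb : ∀ w ∈ Metric.ball z (r / 3), ‖(q : ℂ) ^ d * P d w‖ ≤ q ^ d * C := by
    intro w hw
    rw [norm_mul, norm_pow, Complex.norm_of_nonneg hq0]
    gcongr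
    refine hC _ (hP d) D (hn d) w (fun y hy => hrD ?_)
    rw [Metric.mem_ball] at *
    linarith [dist_triangle4 y w z a]
  refine (norm_fderiv_le_of_forall_mem_ball (hd d) (by positivity) hb).trans_eq ?_
  ring

lemma lintegral_sq_tsum_geometric_mul_lt_top (hP : ∀ d, Differentiable ℂ (P d))
    (hn : ∀ d, (∫⁻ w in D, (‖P d w‖₊ : ℝ≥0∞) ^ 2) ≤ 1) (hq0 : 0 ≤ q) (hq1 : q < 1) :
    (∫⁻ w in D, (‖∑' d, (q : ℂ) ^ d * P d w‖₊ : ℝ≥0∞) ^ 2) < ⊤ := by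
  set s : ℝ≥0∞ := ENNReal.ofReal (Real.sqrt q) with hs
  have hs1 : s ^ 2 < 1 := by
    rw [hs, ← ENNReal.ofReal_pow (Real.sqrt_nonneg _), Real.sq_sqrt hq0]
    simpa using hq1
  have hsum : ∑' d : ℕ, (s ^ d) ^ 2 < ⊤ := by
    simp_rw [← pow_mul, mul_comm _ 2, pow_mul]
    rw [ENNReal.tsum_geometric]
    simpa using hs1
  have hpt (w : Fin n → ℂ) : (‖∑' d, (q : ℂ) ^ d * P d w‖₊ : ℝ≥0∞) ^ 2 ≤
      (∑' d : ℕ, (s ^ d) ^ 2) * ∑' d, (s ^ d) ^ 2 * (‖P d w‖₊ : ℝ≥0∞) ^ 2 := by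
    have h1 : (‖∑' d, (q : ℂ) ^ d * P d w‖₊ : ℝ≥0∞) ≤
        ∑' d : ℕ, s ^ d * (s ^ d * (‖P d w‖₊ : ℝ≥0∞)) := by
      refine (enorm_tsum_le_tsum_enorm (f := fun d => (q : ℂ) ^ d * P d w)).trans_eq ?_
      congr 1
      ext d
      rw [← mul_assoc, ← mul_pow, ← sq, hs, ← ENNReal.ofReal_pow (Real.sqrt_nonneg _),
        Real.sq_sqrt hq0, enorm_mul, enorm_pow, ← ofReal_norm (q : ℂ),
        Complex.norm_of_nonneg hq0, enorm_eq_nnnorm]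
    have h2 := ENNReal.lintegral_mul_le_Lp_mul_Lq (Measure.count : Measure ℕ)
      Real.HolderConjugate.two_two (f := fun d => s ^ d)
      (g := fun d => s ^ d * (‖P d w‖₊ : ℝ≥0∞)) (Measurable.of_discrete.aemeasurable)
      (Measurable.of_discrete.aemeasurable)
    simp only [lintegral_count, Pi.mul_apply, ENNReal.rpow_two] at h2
    refine (pow_le_pow_left₀ zero_le (h1.trans h2) 2).trans_eq ?_
    rw [mul_pow, ← ENNReal.rpow_two, ← ENNReal.rpow_two, ← ENNReal.rpow_mul, ← ENNReal.rpow_mul]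
    simp [mul_pow]
  refine (lintegral_mono hpt).trans_lt ?_
  rw [lintegral_const_mul' _ _ hsum.ne]
  refine ENNReal.mul_lt_top hsum ?_
  have hm (d : ℕ) : Measurable fun w => (‖P d w‖₊ : ℝ≥0∞) ^ 2 := by
    have := (hP d).continuous
    exact Continuous.measurable (by fun_prop)
  rw [lintegral_tsum fun d => ((hm d).const_mul _).aemeasurable]
  refine (ENNReal.tsum_le_tsum fun d => ?_).trans_lt hsum
  rw [lintegral_const_mul _ (hm d)]
  exact mul_le_of_le_one_right' (hn d)

end Series

lemma eval_smul_of_isHomogeneous {n d : ℕ} {P : MvPolynomial (Fin n) ℂ} (hP : P.IsHomogeneous d)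
    (c : ℂ) (z : Fin n → ℂ) :
    MvPolynomial.eval (c • z) P = c ^ d * MvPolynomial.eval z P := by
  rw [MvPolynomial.eval_eq, MvPolynomial.eval_eq, Finset.mul_sum]
  refine Finset.sum_congr rfl fun m hm => ?_
  have hdeg : ∑ i ∈ m.support, m i = d := by
    have := hP (MvPolynomial.mem_support_iff.1 hm)
    rwa [Pi.one_def, ← Finsupp.degree_eq_weight_one, Finsupp.degree_apply] at this
  simp only [Pi.smul_apply, smul_eq_mul, mul_pow, Finset.prod_mul_distrib,
    Finset.prod_pow_eq_pow_sum, hdeg]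
  ring

/-- If a power series converges near `0` to a function holomorphic on a disc, then its terms tend
to `0` at each point of the disc. -/
lemma tendsto_pow_mul_of_differentiableOn {c : ℕ → ℂ} {g : ℂ → ℂ} {R : ℝ}
    (hg : DifferentiableOn ℂ g (Metric.closedBall 0 R))
    (hc : ∀ᶠ x in 𝓝 (0 : ℂ), HasSum (fun d => x ^ d * c d) (g x)) {x : ℂ} (hx : ‖x‖ < R) :
    Tendsto (fun d => x ^ d * c d) atTop (𝓝 0) := by
  have hR : 0 < R := (norm_nonneg x).trans_lt hx
  lift R to ℝ≥0 using hR.le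
  have h1 := hg.hasFPowerSeriesOnBall (by exact_mod_cast hR)
  have h2 : HasFPowerSeriesAt g (FormalMultilinearSeries.ofScalars ℂ c) 0 := by
    rw [hasFPowerSeriesAt_iff]
    simpa using hc
  have h3 := h1.hasFPowerSeriesAt.eq_formalMultilinearSeries h2
  rw [h3] at h1
  have h4 := h1.hasSum (y := x) (by simpa [enorm_eq_nnnorm] using hx)
  simpa [mul_comm] using h4.summable.tendsto_atTop_zero

lemma isOpen_setOf_lt_one {n : ℕ} {h : (Fin n → ℂ) → ℝ} (husc : UpperSemicontinuous h) :
    IsOpen {z | h z < 1} :=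
  husc.isOpen_preimage 1

/-- The pointwise bound `h_BK ≤ h̃`. -/
lemma hBK_le_of_extension {n : ℕ} {h ht : (Fin n → ℂ) → ℝ}
    (husc : UpperSemicontinuous h) (hhom : AbsHomog h)
    (htpos : ∀ z, 0 ≤ ht z) (hthom : AbsHomog ht)
    (hext : ∀ f : (Fin n → ℂ) → ℂ, MemL2h {z | h z < 1} f →
      ∃ F : (Fin n → ℂ) → ℂ, DifferentiableOn ℂ F {z | ht z < 1} ∧
        Set.EqOn F f {z | h z < 1})
    (z : Fin n → ℂ) : hBK h z ≤ ENNReal.ofReal (ht z) := by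
  by_contra! hcon
  obtain ⟨s, hs, hsl⟩ := ENNReal.lt_iff_exists_nnreal_btwn.1 hcon
  have hs' : ht z < s := by
    by_contra hc
    exact hs.not_ge (by simpa using ENNReal.ofReal_le_ofReal (not_lt.1 hc))
  have hfreq : ∃ᶠ d : ℕ in atTop, (s : ℝ≥0∞) ^ d < Md h d z := by
    refine ((frequently_lt_of_lt_limsup (by isBoundedDefault) hsl).and_eventually
      (eventually_gt_atTop 0)).mono fun d hd => ?_
    have hd0 : (0 : ℝ) < d := by exact_mod_cast hd.2
    have := ENNReal.rpow_lt_rpow hd.1 hd0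
    rwa [← ENNReal.rpow_mul, one_div_mul_cancel hd0.ne', ENNReal.rpow_one,
      ENNReal.rpow_natCast] at this
  have hex (d : ℕ) : ∃ P : MvPolynomial (Fin n) ℂ, P.IsHomogeneous d ∧
      (∫⁻ w in {w | h w < 1}, (‖MvPolynomial.eval w P‖₊ : ℝ≥0∞) ^ 2) ≤ 1 ∧
      ((s : ℝ≥0∞) ^ d < Md h d z → (s : ℝ≥0∞) ^ d < ‖MvPolynomial.eval z P‖₊) := by
    by_cases hd : (s : ℝ≥0∞) ^ d < Md h d z
    · have hd' := hd
      simp only [Md, lt_iSup_iff] at hd'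
      obtain ⟨P, h1, h2, h3⟩ := hd'
      exact ⟨P, h1, h2, fun _ => h3⟩
    · exact ⟨0, MvPolynomial.isHomogeneous_zero _ _ _, by simp, fun hd' => absurd hd' hd⟩
  choose P hPhom hPint hPz using hex
  obtain ⟨t, htt, hts⟩ := exists_between hs'
  obtain ⟨t₁, htt₁, ht₁t⟩ := exists_between htt
  have ht₁0 : 0 < t₁ := (htpos z).trans_lt htt₁
  have ht0 : 0 < t := ht₁0.trans ht₁t
  have hs0 : (0 : ℝ) < s := ht0.trans hts
  set q : ℝ := t / s with hq
  have hq0 : 0 ≤ q := by positivity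
  have hq1 : q < 1 := (div_lt_one hs0).2 hts
  have hPdiff (d : ℕ) : Differentiable ℂ fun w => MvPolynomial.eval w (P d) := fun w =>
    (AnalyticOnNhd.eval_mvPolynomial (P d) w (Set.mem_univ w)).differentiableAt
  have hD := isOpen_setOf_lt_one husc
  obtain ⟨F, hF, hFf⟩ := hext _
    ⟨differentiableOn_tsum_geometric_mul hD hPdiff hPint hq0 hq1,
      lintegral_sq_tsum_geometric_mul_lt_top hPdiff hPint hq0 hq1⟩
  have hg : DifferentiableOn ℂ (fun x : ℂ => F (x • z)) (Metric.closedBall 0 t₁⁻¹) := by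
    refine hF.comp (by fun_prop) fun x hx => ?_
    rw [Set.mem_ofPred_eq, hthom]
    have hx' : ‖x‖ ≤ t₁⁻¹ := by simpa using hx
    calc ‖x‖ * ht z ≤ t₁⁻¹ * ht z := by gcongr; exact htpos z
      _ < t₁⁻¹ * t₁ := by gcongr
      _ = 1 := inv_mul_cancel₀ ht₁0.ne'
  have hc : ∀ᶠ x in 𝓝 (0 : ℂ),
      HasSum (fun d => x ^ d * ((q : ℂ) ^ d * MvPolynomial.eval z (P d))) (F (x • z)) := by
    have hnear : ∀ᶠ x : ℂ in 𝓝 0, h (x • z) < 1 := by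
      have : Tendsto (fun x : ℂ => x • z) (𝓝 0) (𝓝 0) := by
        have hcont : Continuous fun x : ℂ => x • z := by fun_prop
        simpa using hcont.tendsto 0
      refine this.eventually (hD.mem_nhds ?_)
      have := hhom 0 0
      simp at this
      simp [this]
    filter_upwards [hnear] with x hx
    have h1 := (summable_geometric_mul hD hPdiff hPint hq0 hq1 hx).hasSum
    rw [hFf hx]
    convert h1 using 2 with d
    rw [eval_smul_of_isHomogeneous (hPhom d)]
    ring
  have hx : ‖((t⁻¹ : ℝ) : ℂ)‖ < t₁⁻¹ := by
    rw [Complex.norm_of_nonneg (by positivity)]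
    gcongr
  have hlim := (tendsto_pow_mul_of_differentiableOn hg hc hx).norm.eventually
    (gt_mem_nhds (by simp : ‖(0 : ℂ)‖ < 1))
  obtain ⟨d, hd, hd1⟩ := (hfreq.and_eventually hlim).exists
  have hd2 : (s : ℝ) ^ d < ‖MvPolynomial.eval z (P d)‖ := by
    have := hPz d hd
    exact_mod_cast this
  refine hd1.not_ge ?_
  rw [norm_mul, norm_mul, norm_pow, norm_pow, Complex.norm_of_nonneg (by positivity),
    Complex.norm_of_nonneg hq0, ← mul_assoc, ← mul_pow]
  have : t⁻¹ * q = (s : ℝ)⁻¹ := by rw [hq]; field_simp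
  rw [this, inv_pow]
  calc (1 : ℝ) = ((s : ℝ) ^ d)⁻¹ * (s : ℝ) ^ d := (inv_mul_cancel₀ (by positivity)).symm
    _ ≤ _ := by gcongr

/-- if every `f ∈ L²_h(D_h)` extends holomorphically to the balanced domain
`D_{h̃}` with `h̃ ≤ h`, then `h̃ ≥ h_BK^*`. -/
theorem statement_1 (n : ℕ) (h ht : (Fin n → ℂ) → ℝ)
    (hpos : ∀ z, 0 ≤ h z) (husc : UpperSemicontinuous h) (hhom : AbsHomog h)
    (hne : ∃ z, h z ≠ 0)
    (htpos : ∀ z, 0 ≤ ht z) (htusc : UpperSemicontinuous ht) (hthom : AbsHomog ht)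
    (hle : ∀ z, ht z ≤ h z)
    (hext : ∀ f : (Fin n → ℂ) → ℂ, MemL2h {z | h z < 1} f →
      ∃ F : (Fin n → ℂ) → ℂ, DifferentiableOn ℂ F {z | ht z < 1} ∧
        Set.EqOn F f {z | h z < 1}) :
    ∀ z, hBKstar h z ≤ ENNReal.ofReal (ht z) := by
  intro z
  refine le_of_forall_gt_imp_ge_of_dense fun b hb => ?_
  obtain ⟨s, hs, hsb⟩ := ENNReal.lt_iff_exists_nnreal_btwn.1 hb
  have hs' : ht z < s := by
    by_contra hcon
    exact hs.not_ge (by simpa using ENNReal.ofReal_le_ofReal (not_lt.1 hcon))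
  refine (limsup_le_of_le (by isBoundedDefault) ?_).trans hsb.le
  filter_upwards [htusc z s hs'] with w hw
  refine (hBK_le_of_extension husc hhom htpos hthom hext w).trans ?_
  simpa using ENNReal.ofReal_le_ofReal hw.le
end
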